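/- Under Assumption on 𝔞 (|𝔞(x)| ≲ |x|^γ for |x|<1, ≲ |x|^δ for |x|≥1, with 3+α ≤ γ ≤ δ < ∞) and Θ bounded (c₁ ≤ Θ ≤ c₂), the singular potential W^{ε,p}_𝔞(x) = ε^{β(α-γ+2)}( 2ε^{-2+βα}|x|^α Θ(ϑ)𝔞(ε^β x) - 2p ε^{-1}𝔞(ε^β x) + ε^{-2}𝔞(ε^β x)² ), with β = 1/(α+1), satisfies |W^{ε,p}_𝔞(x)| ≲ (1+|p|)(1+|x|)^{2δ} uniformly for ε ∈ (0,1). -/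

import Mathlib

/-- Under the assumptions `|𝔞(x)| ≤ C|x|^γ` for `|x|<1`, `|𝔞(x)| ≤ C|x|^δ` for `|x|≥1`
with `3+α ≤ γ ≤ δ < ∞`, and `Θ` bounded (`c₁ ≤ Θ ≤ c₂`), the singular potential
`W^{ε,p}_𝔞(x) = ε^{β(α-γ+2)}( 2ε^{-2+βα}|x|^α Θ(ϑ)𝔞(ε^β x) - 2p ε^{-1}𝔞(ε^β x)
+ ε^{-2}𝔞(ε^β x)² )`, with `β = 1/(α+1)`, satisfies
`|W^{ε,p}_𝔞(x)| ≤ C''(1+|p|)(1+|x|)^{2δ}` uniformly for `ε ∈ (0,1)`. -/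
theorem singular_potential_polynomial_bound
    (α β γ δ c₁ c₂ C : ℝ) (hα : 0 < α) (hβ : β = 1 / (α + 1))
    (hγ : 3 + α ≤ γ) (hγδ : γ ≤ δ) (hc₁ : 0 < c₁) (hC : 0 ≤ C)
    (Θ : ℝ → ℝ) (ϑ : EuclideanSpace ℝ (Fin 2) → ℝ)
    (hΘ : ∀ t, c₁ ≤ Θ t ∧ Θ t ≤ c₂)
    (𝔞 : EuclideanSpace ℝ (Fin 2) → ℝ)
    (h𝔞₁ : ∀ x, ‖x‖ < 1 → |𝔞 x| ≤ C * ‖x‖ ^ γ)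
    (h𝔞₂ : ∀ x, 1 ≤ ‖x‖ → |𝔞 x| ≤ C * ‖x‖ ^ δ)
    (W : ℝ → ℝ → EuclideanSpace ℝ (Fin 2) → ℝ)
    (hW : ∀ (ε p : ℝ) (x : EuclideanSpace ℝ (Fin 2)),
      W ε p x = ε ^ (β * (α - γ + 2)) *
        (2 * ε ^ (-2 + β * α) * ‖x‖ ^ α * Θ (ϑ x) * 𝔞 ((ε ^ β : ℝ) • x)
          - 2 * p * ε ^ (-1 : ℝ) * 𝔞 ((ε ^ β : ℝ) • x)
          + ε ^ (-2 : ℝ) * (𝔞 ((ε ^ β : ℝ) • x)) ^ 2)) :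
    ∃ C'' : ℝ, 0 < C'' ∧
      ∀ (ε p : ℝ), 0 < ε → ε < 1 →
        ∀ x : EuclideanSpace ℝ (Fin 2),
          |W ε p x| ≤ C'' * (1 + |p|) * (1 + ‖x‖) ^ (2 * δ) := by
  have hβ0 : 0 < β := by rw [hβ]; positivity
  have hβ1 : β * (α + 1) = 1 := by rw [hβ]; field_simp
  have hc₂ : 0 < c₂ := lt_of_lt_of_le hc₁ ((hΘ 0).1.trans (hΘ 0).2)
  refine ⟨2 * c₂ * C + 2 * C + C ^ 2 + 1, by positivity, ?_⟩
  intro ε p hε hε1 x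
  have hr : 0 ≤ ‖x‖ := norm_nonneg x
  have hn : ‖(ε ^ β : ℝ) • x‖ = ε ^ β * ‖x‖ := by
    rw [norm_smul, Real.norm_of_nonneg (Real.rpow_nonneg hε.le _)]
  set P : ℝ := (1 + ‖x‖) ^ δ with hP
  have hP1 : 1 ≤ P := Real.one_le_rpow (by linarith) (by linarith)
  have hPP : (1 + ‖x‖) ^ (2 * δ) = P * P := by
    rw [hP, ← Real.rpow_add (by linarith)]; ring_nf
  have hle : ∀ s, 0 ≤ s → s ≤ δ → ‖x‖ ^ s ≤ P := fun s hs hsδ =>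
    (Real.rpow_le_rpow hr (by linarith) hs).trans
      (Real.rpow_le_rpow_of_exponent_le (by linarith) hsδ)
  have hA : |𝔞 ((ε ^ β : ℝ) • x)| ≤ ε ^ (β * γ) * (C * P) := by
    have hmul : ∀ s, (ε ^ β * ‖x‖) ^ s = ε ^ (β * s) * ‖x‖ ^ s := fun s => by
      rw [Real.mul_rpow (Real.rpow_nonneg hε.le _) hr, ← Real.rpow_mul hε.le]
    have key : ∀ s, γ ≤ s → s ≤ δ → C * (ε ^ β * ‖x‖) ^ s ≤ ε ^ (β * γ) * (C * P) := by
      intro s h1 h2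
      rw [hmul]
      have e1 : ε ^ (β * s) ≤ ε ^ (β * γ) :=
        Real.rpow_le_rpow_of_exponent_ge hε hε1.le (mul_le_mul_of_nonneg_left h1 hβ0.le)
      have e2 := hle s (by linarith) h2
      calc C * (ε ^ (β * s) * ‖x‖ ^ s) ≤ C * (ε ^ (β * γ) * P) := by gcongr
        _ = _ := by ring
    rcases lt_or_ge ‖(ε ^ β : ℝ) • x‖ 1 with h | h
    · have := h𝔞₁ _ h
      rw [hn] at this
      exact this.trans (key γ le_rfl hγδ)
    · have := h𝔞₂ _ h
      rw [hn] at this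
      exact this.trans (key δ hγδ le_rfl)
  have f1 : ε ^ (β * (α - γ + 2)) * ε ^ (-2 + β * α) * ε ^ (β * γ) ≤ 1 := by
    rw [← Real.rpow_add hε, ← Real.rpow_add hε]
    exact Real.rpow_le_one hε.le hε1.le (by nlinarith)
  have f2 : ε ^ (β * (α - γ + 2)) * ε ^ (-1 : ℝ) * ε ^ (β * γ) ≤ 1 := by
    rw [← Real.rpow_add hε, ← Real.rpow_add hε]
    exact Real.rpow_le_one hε.le hε1.le (by nlinarith)
  have f3 : ε ^ (β * (α - γ + 2)) * ε ^ (-2 : ℝ) * (ε ^ (β * γ) * ε ^ (β * γ)) ≤ 1 := by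
    rw [← Real.rpow_add hε, ← Real.rpow_add hε, ← Real.rpow_add hε]
    exact Real.rpow_le_one hε.le hε1.le (by nlinarith)
  have hT : |Θ (ϑ x)| ≤ c₂ := by
    rw [abs_of_pos (lt_of_lt_of_le hc₁ (hΘ _).1)]; exact (hΘ _).2
  have hxα := hle α hα.le (by linarith)
  have hxα0 : 0 ≤ ‖x‖ ^ α := Real.rpow_nonneg hr _
  rw [hW, hPP]
  generalize 𝔞 ((ε ^ β : ℝ) • x) = a at *
  generalize Θ (ϑ x) = T at *
  have p1 : 0 ≤ ε ^ (β * (α - γ + 2)) := Real.rpow_nonneg hε.le _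
  have p2 : 0 ≤ ε ^ (-2 + β * α) := Real.rpow_nonneg hε.le _
  have p3 : 0 ≤ ε ^ (-1 : ℝ) := Real.rpow_nonneg hε.le _
  have p4 : 0 ≤ ε ^ (-2 : ℝ) := Real.rpow_nonneg hε.le _
  have p5 : 0 ≤ ε ^ (β * γ) := Real.rpow_nonneg hε.le _
  generalize ε ^ (β * (α - γ + 2)) = E at *
  generalize ε ^ (-2 + β * α) = E1 at *
  generalize ε ^ (-1 : ℝ) = E2 at *
  generalize ε ^ (-2 : ℝ) = E3 at *
  generalize ε ^ (β * γ) = G at *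
  generalize ‖x‖ ^ α = R at *
  clear_value P
  have hP0 : 0 ≤ P := by linarith
  have hp : 0 ≤ |p| := abs_nonneg p
  have b1 : |E * (2 * E1 * R * T * a)| ≤ 2 * c₂ * C * (P * P) := by
    rw [show E * (2 * E1 * R * T * a) = (E * E1 * (2 * R)) * T * a by ring, abs_mul, abs_mul,
      abs_of_nonneg (by positivity)]
    calc E * E1 * (2 * R) * |T| * |a| ≤ E * E1 * (2 * P) * c₂ * (G * (C * P)) := by gcongr
      _ = (E * E1 * G) * (2 * c₂ * C * (P * P)) := by ring
      _ ≤ 1 * (2 * c₂ * C * (P * P)) := by gcongr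
      _ = _ := one_mul _
  have b2 : |E * (2 * p * E2 * a)| ≤ 2 * C * |p| * (P * P) := by
    rw [show E * (2 * p * E2 * a) = (E * E2 * 2) * p * a by ring, abs_mul, abs_mul,
      abs_of_nonneg (by positivity)]
    calc E * E2 * 2 * |p| * |a| ≤ E * E2 * 2 * |p| * (G * (C * P)) := by gcongr
      _ = (E * E2 * G) * (2 * C * |p| * (P * 1)) := by ring
      _ ≤ 1 * (2 * C * |p| * (P * P)) := by gcongr
      _ = _ := one_mul _
  have b3 : |E * (E3 * a ^ 2)| ≤ C ^ 2 * (P * P) := by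
    rw [show E * (E3 * a ^ 2) = (E * E3) * (a * a) by ring, abs_mul, abs_mul a a,
      abs_of_nonneg (by positivity)]
    calc E * E3 * (|a| * |a|) ≤ E * E3 * ((G * (C * P)) * (G * (C * P))) := by gcongr
      _ = (E * E3 * (G * G)) * (C ^ 2 * (P * P)) := by ring
      _ ≤ 1 * (C ^ 2 * (P * P)) := by gcongr
      _ = _ := one_mul _
  have e : E * (2 * E1 * R * T * a - 2 * p * E2 * a + E3 * a ^ 2)
      = E * (2 * E1 * R * T * a) - E * (2 * p * E2 * a) + E * (E3 * a ^ 2) := by ring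
  rw [e]
  refine (abs_add_le _ _).trans ?_
  have h4 := abs_sub (E * (2 * E1 * R * T * a)) (E * (2 * p * E2 * a))
  have h5 : 0 ≤ (2 * c₂ * C * |p| + 2 * C + C ^ 2 * |p| + 1 + |p|) * (P * P) := by positivity
  nlinarith
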